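/- Fix an integer z ≥ 1, define ζ(l) = C(z+l, z) for integers l ≥ 0 and ζ(-1) = 0, and let β_nc(φ) = Σ_{l=0}^∞ (z+l) · (φ^{ζ(l-1)} − φ^{ζ(l)}). Then for every real φ with 0 < φ < 1, β_nc is differentiable at φ with derivative β_nc'(φ) = Σ_{l=0}^∞ ζ(l) · φ^{ζ(l)−1}, and this derivative is strictly positive. -/

import Mathlib

/-- `zetaPrev z l = ζ(l-1)` where `ζ(l) = C(z+l, z)` for `l ≥ 0` and `ζ(-1) = 0`. -/
def zetaPrev (z : ℕ) : ℕ → ℕ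
  | 0 => 0
  | l + 1 => (z + l).choose z

/-- `β_nc(φ) = Σ_{l=0}^∞ (z+l) · (φ^{ζ(l-1)} − φ^{ζ(l)})`. -/
noncomputable def betaNC (z : ℕ) (φ : ℝ) : ℝ :=
  ∑' l : ℕ, ((z : ℝ) + l) * (φ ^ zetaPrev z l - φ ^ (z + l).choose z)

lemma strictMono_add_choose {z : ℕ} (hz : 1 ≤ z) :
    StrictMono fun l : ℕ => (z + l).choose z := by
  refine strictMono_nat_of_lt_succ fun l => ?_
  obtain ⟨k, rfl⟩ : ∃ k, z = k + 1 := ⟨z - 1, by omega⟩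
  have h : (k + 1 + (l + 1)).choose (k + 1)
      = (k + 1 + l).choose k + (k + 1 + l).choose (k + 1) := Nat.choose_succ_succ _ _
  have hpos : 0 < (k + 1 + l).choose k := Nat.choose_pos (by omega)
  change (k + 1 + l).choose (k + 1) < (k + 1 + (l + 1)).choose (k + 1)
  omega

lemma summable_natCast_mul_pow_sub_one {r : ℝ} (h0 : 0 < r) (h1 : r < 1) :
    Summable fun n : ℕ => (n : ℝ) * r ^ (n - 1) := by
  have h := summable_pow_mul_geometric_of_norm_lt_one (R := ℝ) 1
    (r := r) (by rwa [Real.norm_of_nonneg h0.le])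
  refine (h.mul_right r⁻¹).congr fun n => ?_
  cases n with
  | zero => simp
  | succ n => simp only [Nat.add_sub_cancel, pow_succ]; field_simp

/-- Summation by parts: `β_nc(x) = z + Σ_{l=0}^∞ x^{ζ(l)}`. -/
lemma betaNC_eq_add_tsum {z : ℕ} (hz : 1 ≤ z) {x : ℝ} (h0 : 0 < x) (h1 : x < 1) :
    betaNC z x = z + ∑' l : ℕ, x ^ (z + l).choose z := by
  have hmono := strictMono_add_choose hz
  have hgeom : Summable fun l : ℕ => x ^ l := summable_geometric_of_lt_one h0.le h1
  have hpow : Summable fun l : ℕ => x ^ (z + l).choose z := hgeom.comp_injective hmono.injective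
  set a : ℕ → ℝ := fun l => ((z : ℝ) + l) * x ^ zetaPrev z l with ha
  have ha_succ : Summable fun l => a (l + 1) := by
    have hlin : Summable fun l : ℕ => (l : ℝ) ^ 1 * x ^ l :=
      summable_pow_mul_geometric_of_norm_lt_one (R := ℝ) 1 (by rwa [Real.norm_of_nonneg h0.le])
    refine Summable.of_nonneg_of_le (fun l => by positivity) (fun l => ?_)
      ((hgeom.mul_left ((z : ℝ) + 1)).add hlin)
    have hle : x ^ (z + l).choose z ≤ x ^ l :=
      pow_le_pow_of_le_one h0.le h1.le hmono.le_apply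
    calc a (l + 1) = ((z : ℝ) + 1 + l) * x ^ (z + l).choose z := by
          simp only [ha, zetaPrev]; push_cast; ring
      _ ≤ ((z : ℝ) + 1 + l) * x ^ l := by gcongr
      _ = ((z : ℝ) + 1) * x ^ l + (l : ℝ) ^ 1 * x ^ l := by ring
  have ha_sum : Summable a := (summable_nat_add_iff 1).mp ha_succ
  have hterm : ∀ l : ℕ, ((z : ℝ) + l) * (x ^ zetaPrev z l - x ^ (z + l).choose z)
      = (a l - a (l + 1)) + x ^ (z + l).choose z := by
    intro l
    simp only [ha, zetaPrev]
    push_cast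
    ring
  have ha_zero : a 0 = z := by simp [ha, zetaPrev]
  rw [betaNC, tsum_congr hterm, (ha_sum.sub ha_succ).tsum_add hpow, ha_sum.tsum_sub ha_succ,
    ha_sum.tsum_eq_zero_add, ha_zero]
  ring

/-- For every real `φ` with `0 < φ < 1`, `β_nc` is differentiable at `φ`
with derivative `Σ_{l=0}^∞ ζ(l) · φ^{ζ(l)−1}`, and this derivative is strictly positive. -/
theorem betaNC_hasDerivAt_and_deriv_pos (z : ℕ) (hz : 1 ≤ z) (φ : ℝ)
    (h0 : 0 < φ) (h1 : φ < 1) :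
    HasDerivAt (betaNC z)
        (∑' l : ℕ, ((z + l).choose z : ℝ) * φ ^ ((z + l).choose z - 1)) φ ∧
      0 < ∑' l : ℕ, ((z + l).choose z : ℝ) * φ ^ ((z + l).choose z - 1) := by
  have hinj := (strictMono_add_choose hz).injective
  have hsum : ∀ {r : ℝ}, 0 < r → r < 1 →
      Summable fun l : ℕ => ((z + l).choose z : ℝ) * r ^ ((z + l).choose z - 1) :=
    fun hr0 hr1 => (summable_natCast_mul_pow_sub_one hr0 hr1).comp_injective hinj
  constructor
  · obtain ⟨r, hφr, hr1⟩ := exists_between h1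
    have hφ : φ ∈ Set.Ioo 0 r := ⟨h0, hφr⟩
    have hderiv : HasDerivAt (fun x : ℝ => ∑' l : ℕ, x ^ (z + l).choose z)
        (∑' l : ℕ, ((z + l).choose z : ℝ) * φ ^ ((z + l).choose z - 1)) φ := by
      refine hasDerivAt_tsum_of_isPreconnected (hsum (h0.trans hφr) hr1) isOpen_Ioo
        isPreconnected_Ioo (fun l y _ => hasDerivAt_pow _ y) (fun l y hy => ?_) hφ
        ((summable_geometric_of_lt_one h0.le h1).comp_injective hinj) hφ
      have hy0 : 0 ≤ y := hy.1.le
      rw [Real.norm_of_nonneg (by positivity)]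
      gcongr
      exact hy.2.le
    refine (hderiv.const_add (z : ℝ)).congr_of_eventuallyEq ?_
    filter_upwards [Ioo_mem_nhds h0 h1] with x hx
    exact betaNC_eq_add_tsum hz hx.1 hx.2
  · exact (hsum h0 h1).tsum_pos (fun l => by positivity) 0 (by simp)
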